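/- arXiv:1807.08661 — 2 statements merged into one kernel-verified Lean document; each statement's English description precedes it below -/
import Mathlib

section
/- For every N > 0 and every ε > 0 there exist real numbers a and b with a < -N and 0 < b < ε such that (B₁(a,b) + C₁(a,b))/A₁(a,b) = (B₂(a,b) + C₂(a,b))/A₂(a,b). (There are solutions of the CS-4 period problem with a arbitrarily negative and b arbitrarily small; this is the key step toward the Costa-surface limit of the CS-4 family.) -/
open MeasureTheory Set

/-- A₁(a,b) = ∫_a^0 (z-a)^{1/2}(-z)^{-3/4}(b-z)^{-3/4}(1-z)^{-3/4} dz -/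
noncomputable def A1 (a b : ℝ) : ℝ :=
  ∫ z in Ioo a 0, (z - a) ^ ((1:ℝ)/2) * (-z) ^ (-(3:ℝ)/4) * (b - z) ^ (-(3:ℝ)/4) * (1 - z) ^ (-(3:ℝ)/4)

/-- B₁(a,b) = ∫_{-∞}^a (a-z)^{1/2}(-z)^{-3/4}(b-z)^{-3/4}(1-z)^{-3/4} dz -/
noncomputable def B1 (a b : ℝ) : ℝ :=
  ∫ z in Iio a, (a - z) ^ ((1:ℝ)/2) * (-z) ^ (-(3:ℝ)/4) * (b - z) ^ (-(3:ℝ)/4) * (1 - z) ^ (-(3:ℝ)/4)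

/-- C₁(a,b) = ∫_b^1 (z-a)^{1/2} z^{-3/4}(z-b)^{-3/4}(1-z)^{-3/4} dz -/
noncomputable def C1 (a b : ℝ) : ℝ :=
  ∫ z in Ioo b 1, (z - a) ^ ((1:ℝ)/2) * z ^ (-(3:ℝ)/4) * (z - b) ^ (-(3:ℝ)/4) * (1 - z) ^ (-(3:ℝ)/4)

/-- A₂(a,b) = ∫_a^0 (z-a)^{-1/2}(-z)^{-1/4}(b-z)^{-1/4}(1-z)^{-1/4} dz -/
noncomputable def A2 (a b : ℝ) : ℝ :=
  ∫ z in Ioo a 0, (z - a) ^ (-(1:ℝ)/2) * (-z) ^ (-(1:ℝ)/4) * (b - z) ^ (-(1:ℝ)/4) * (1 - z) ^ (-(1:ℝ)/4)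

/-- B₂(a,b) = ∫_{-∞}^a (a-z)^{-1/2}(-z)^{-1/4}(b-z)^{-1/4}(1-z)^{-1/4} dz -/
noncomputable def B2 (a b : ℝ) : ℝ :=
  ∫ z in Iio a, (a - z) ^ (-(1:ℝ)/2) * (-z) ^ (-(1:ℝ)/4) * (b - z) ^ (-(1:ℝ)/4) * (1 - z) ^ (-(1:ℝ)/4)

/-- C₂(a,b) = ∫_b^1 (z-a)^{-1/2} z^{-1/4}(z-b)^{-1/4}(1-z)^{-1/4} dz -/
noncomputable def C2 (a b : ℝ) : ℝ :=
  ∫ z in Ioo b 1, (z - a) ^ (-(1:ℝ)/2) * z ^ (-(1:ℝ)/4) * (z - b) ^ (-(1:ℝ)/4) * (1 - z) ^ (-(1:ℝ)/4)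

theorem setIntegral_eq_mul_of_substitution {s t : Set ℝ} {f k f' g h : ℝ → ℝ} {K : ℝ}
    (hs : MeasurableSet s) (hd : ∀ x ∈ s, HasDerivAt f (f' x) x)
    (hf : MapsTo f s t) (hk : MapsTo k t s) (hl : ∀ x ∈ s, k (f x) = x)
    (hr : ∀ y ∈ t, f (k y) = y) (H : ∀ x ∈ s, |f' x| * g (f x) = K * h x) :
    ∫ z in t, g z = K * ∫ x in s, h x := by
  have himg : f '' s = t :=
    Subset.antisymm hf.image_subset fun y hy => ⟨k y, hk hy, hr y hy⟩
  have hinj : InjOn f s := fun x hx y hy hxy => by rw [← hl x hx, hxy, hl y hy]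
  rw [← himg, integral_image_eq_integral_abs_deriv_smul hs
    (fun x hx => (hd x hx).hasDerivWithinAt) hinj, ← integral_const_mul]
  exact setIntegral_congr_fun hs fun x hx => by simpa using H x hx

theorem exists_pos_pow_four_eq {x : ℝ} (hx : 0 < x) : ∃ y, 0 < y ∧ x = y ^ 4 :=
  ⟨x ^ ((1:ℝ)/4), by positivity, by
    rw [← Real.rpow_natCast, ← Real.rpow_mul hx.le]; norm_num⟩

theorem pow_four_rpow_div_four {y : ℝ} (hy : 0 < y) (r : ℝ) (n : ℤ) (hr : 4 * r = n) :
    (y ^ 4) ^ r = y ^ n := by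
  rw [← Real.rpow_natCast, ← Real.rpow_mul hy.le, ← Real.rpow_intCast, ← hr]; norm_num

theorem pow_four_rpow_half {y : ℝ} (hy : 0 < y) : (y ^ 4) ^ ((1:ℝ)/2) = y ^ 2 := by
  simpa using pow_four_rpow_div_four hy ((1:ℝ)/2) 2 (by norm_num)

theorem pow_four_rpow_neg_half {y : ℝ} (hy : 0 < y) : (y ^ 4) ^ (-(1:ℝ)/2) = (y ^ 2)⁻¹ := by
  simpa using pow_four_rpow_div_four hy (-(1:ℝ)/2) (-2) (by norm_num)

theorem pow_four_rpow_quarter {y : ℝ} (hy : 0 < y) : (y ^ 4) ^ ((1:ℝ)/4) = y := by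
  simpa using pow_four_rpow_div_four hy ((1:ℝ)/4) 1 (by norm_num)

theorem pow_four_rpow_three_quarters {y : ℝ} (hy : 0 < y) : (y ^ 4) ^ ((3:ℝ)/4) = y ^ 3 := by
  simpa using pow_four_rpow_div_four hy ((3:ℝ)/4) 3 (by norm_num)

theorem pow_four_rpow_neg_quarter {y : ℝ} (hy : 0 < y) : (y ^ 4) ^ (-(1:ℝ)/4) = y⁻¹ := by
  simpa using pow_four_rpow_div_four hy (-(1:ℝ)/4) (-1) (by norm_num)

theorem pow_four_rpow_neg_three_quarters {y : ℝ} (hy : 0 < y) :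
    (y ^ 4) ^ (-(3:ℝ)/4) = (y ^ 3)⁻¹ := by
  simpa using pow_four_rpow_div_four hy (-(3:ℝ)/4) (-3) (by norm_num)

theorem pow_four_rpow_neg_five_quarters {y : ℝ} (hy : 0 < y) :
    (y ^ 4) ^ (-(5:ℝ)/4) = (y ^ 5)⁻¹ := by
  simpa using pow_four_rpow_div_four hy (-(5:ℝ)/4) (-5) (by norm_num)

/-- Rescaled integrand of `A1 (-β⁻¹) b`, for the variable `u = -z / b`. -/
noncomputable def kernelA1 (β b u : ℝ) : ℝ :=
  u ^ (-(3:ℝ)/4) * (1 + u) ^ (-(3:ℝ)/4) * (1 + b * u) ^ (-(3:ℝ)/4) * (1 - β * b * u) ^ ((1:ℝ)/2)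

/-- Rescaled integrand of `B1 (-β⁻¹) b`, for the variable `u = -1 / (β z)`. -/
noncomputable def kernelB1 (β b u : ℝ) : ℝ :=
  (1 - u) ^ ((1:ℝ)/2) * u ^ (-(1:ℝ)/4) * (1 + β * b * u) ^ (-(3:ℝ)/4) * (1 + β * u) ^ (-(3:ℝ)/4)

/-- Rescaled integrand of `C1 (-β⁻¹) b`, for the variable `u` with `z = b (1 + u) / (1 + b u)`. -/
noncomputable def kernelC1 (β b u : ℝ) : ℝ :=
  u ^ (-(3:ℝ)/4) * (1 + u) ^ (-(3:ℝ)/4) * (1 + b * u) ^ ((1:ℝ)/4) *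
    (1 + β * (b * (1 + u) / (1 + b * u))) ^ ((1:ℝ)/2)

/-- Rescaled integrand of `A2 (-β⁻¹) b`, for the variable `u = -β z`. -/
noncomputable def kernelA2 (β b u : ℝ) : ℝ :=
  (1 - u) ^ (-(1:ℝ)/2) * u ^ (-(1:ℝ)/4) * (u + β * b) ^ (-(1:ℝ)/4) * (u + β) ^ (-(1:ℝ)/4)

/-- Rescaled integrand of `B2 (-β⁻¹) b`, for the variable `u = -1 / (β z)`. -/
noncomputable def kernelB2 (β b u : ℝ) : ℝ :=
  (1 - u) ^ (-(1:ℝ)/2) * u ^ (-(3:ℝ)/4) * (1 + β * b * u) ^ (-(1:ℝ)/4) * (1 + β * u) ^ (-(1:ℝ)/4)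

/-- Rescaled integrand of `C2 (-β⁻¹) b`, for the variable `u` with `z = (b + u) / (1 + u)`. -/
noncomputable def kernelC2 (β b u : ℝ) : ℝ :=
  u ^ (-(1:ℝ)/4) * (b + u) ^ (-(1:ℝ)/4) * (1 + u) ^ (-(5:ℝ)/4) *
    (1 + β * ((b + u) / (1 + u))) ^ (-(1:ℝ)/2)

theorem A1_eq {β b : ℝ} (hβ : 0 < β) (hb : 0 < b) :
    A1 (-β⁻¹) b = b ^ (-(1:ℝ)/2) * β ^ (-(1:ℝ)/2) * ∫ u in Ioi 0, kernelA1 β b u := by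
  have hsub : ∫ u in Ioi 0, kernelA1 β b u = ∫ u in Ioo 0 (β * b)⁻¹, kernelA1 β b u := by
    refine setIntegral_eq_of_subset_of_forall_sdiff_eq_zero measurableSet_Ioi
      Ioo_subset_Ioi_self fun u hu => ?_
    have hu' : (β * b)⁻¹ ≤ u := by
      by_contra! h
      exact hu.2 ⟨hu.1, h⟩
    have h1 : 1 - β * b * u ≤ 0 := by
      rw [inv_le_iff_one_le_mul₀ (by positivity)] at hu'
      linarith
    rw [kernelA1, ← Real.sqrt_eq_rpow, Real.sqrt_eq_zero_of_nonpos h1, mul_zero]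
  rw [hsub, A1]
  refine setIntegral_eq_mul_of_substitution (f := fun u => -(b * u)) (k := fun z => -z / b)
    (f' := fun _ => -b) measurableSet_Ioo ?_ ?_ ?_ ?_ ?_ ?_
  · intro x _
    simpa using ((hasDerivAt_id' x).const_mul b).fun_neg
  · rintro u ⟨h0, h1⟩
    rw [lt_inv_comm₀ h0 (by positivity), ← one_div, lt_div_iff₀ h0] at h1
    refine ⟨?_, by simp only [Left.neg_neg_iff]; positivity⟩
    rw [neg_lt_neg_iff, ← one_div, lt_div_iff₀ hβ]
    linarith
  · rintro z ⟨h0, h1⟩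
    refine ⟨div_pos (by linarith) hb, ?_⟩
    rw [div_lt_iff₀ hb, mul_inv]
    field_simp
    rw [neg_lt, ← one_div, lt_div_iff₀ hβ] at h0
    linarith
  · intro u _
    field_simp
  · intro z _
    field_simp
  · rintro u ⟨h0, h1⟩
    have h2 : 0 < 1 - β * b * u := by
      rw [lt_inv_comm₀ h0 (by positivity), ← one_div, lt_div_iff₀ h0] at h1
      linarith
    obtain ⟨y, hy, rfl⟩ := exists_pos_pow_four_eq hb
    obtain ⟨r, hr, rfl⟩ := exists_pos_pow_four_eq hβ
    obtain ⟨v, hv, rfl⟩ := exists_pos_pow_four_eq h0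
    obtain ⟨w, hw, h3⟩ := exists_pos_pow_four_eq (show 0 < 1 + v ^ 4 by positivity)
    obtain ⟨q, hq, h4⟩ := exists_pos_pow_four_eq (show 0 < 1 + y ^ 4 * v ^ 4 by positivity)
    obtain ⟨p, hp, h5⟩ := exists_pos_pow_four_eq h2
    have e1 : -(y ^ 4 * v ^ 4) - -(r ^ 4)⁻¹ = (p / r) ^ 4 := by
      rw [div_pow, ← h5]; field_simp; ring
    have e2 : - -(y ^ 4 * v ^ 4) = (y * v) ^ 4 := by ring
    have e3 : y ^ 4 - -(y ^ 4 * v ^ 4) = (y * w) ^ 4 := by rw [mul_pow, ← h3]; ring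
    have e4 : 1 - -(y ^ 4 * v ^ 4) = q ^ 4 := by rw [← h4]; ring
    rw [kernelA1, e1, e2, e3, e4, h3, h4, h5, abs_neg, abs_of_pos hb]
    simp (disch := positivity) only [pow_four_rpow_half, pow_four_rpow_neg_half,
      pow_four_rpow_neg_three_quarters]
    field_simp

theorem setIntegral_Iio_eq_mul_of_inversion {g h : ℝ → ℝ} {β K : ℝ} (hβ : 0 < β)
    (H : ∀ u ∈ Ioo (0:ℝ) 1, (β * u ^ 2)⁻¹ * g (-(β * u)⁻¹) = K * h u) :
    ∫ z in Iio (-β⁻¹), g z = K * ∫ u in Ioo 0 1, h u := by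
  refine setIntegral_eq_mul_of_substitution (f := fun u => -(β * u)⁻¹) (k := fun z => -(β * z)⁻¹)
    (f' := fun u => (β * u ^ 2)⁻¹) measurableSet_Ioo ?_ ?_ ?_ ?_ ?_ ?_
  · rintro x ⟨hx, _⟩
    refine ((((hasDerivAt_id' x).const_mul β).fun_inv (mul_pos hβ hx).ne').fun_neg).congr_deriv ?_
    field_simp
  · rintro u ⟨h0, h1⟩
    simp only [mem_Iio, neg_lt_neg_iff]
    gcongr
    nlinarith
  · intro z hz
    have hz' : 1 < β * (-z) := by
      have := mul_lt_mul_of_pos_left (mem_Iio.1 hz) hβ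
      rw [mul_neg, mul_inv_cancel₀ hβ.ne'] at this
      linarith
    have : -(β * z)⁻¹ = (β * -z)⁻¹ := by rw [mul_neg, inv_neg]
    simp only [this]
    exact ⟨by positivity, inv_lt_one_of_one_lt₀ hz'⟩
  · rintro u ⟨h0, _⟩
    field_simp
  · intro z hz
    have : z ≠ 0 := by
      have : z < -β⁻¹ := hz
      have : 0 < β⁻¹ := by positivity
      linarith
    field_simp
  · intro u hu
    rw [← H u hu, abs_of_pos (inv_pos.2 (mul_pos hβ (pow_pos hu.1 2)))]

theorem B1_eq {β b : ℝ} (hβ : 0 < β) (hb : 0 < b) :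
    B1 (-β⁻¹) b = β ^ ((3:ℝ)/4) * ∫ u in Ioo 0 1, kernelB1 β b u := by
  rw [B1]
  refine setIntegral_Iio_eq_mul_of_inversion hβ ?_
  rintro u ⟨h0, h1⟩
  have h2 : 0 < 1 - u := by linarith
  obtain ⟨y, hy, rfl⟩ := exists_pos_pow_four_eq hb
  obtain ⟨r, hr, rfl⟩ := exists_pos_pow_four_eq hβ
  obtain ⟨v, hv, rfl⟩ := exists_pos_pow_four_eq h0
  obtain ⟨w, hw, h3⟩ := exists_pos_pow_four_eq (show 0 < 1 + r ^ 4 * v ^ 4 by positivity)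
  obtain ⟨q, hq, h4⟩ := exists_pos_pow_four_eq (show 0 < 1 + r ^ 4 * y ^ 4 * v ^ 4 by positivity)
  obtain ⟨p, hp, h5⟩ := exists_pos_pow_four_eq h2
  have e1 : -(r ^ 4)⁻¹ - -(r ^ 4 * v ^ 4)⁻¹ = (p / (r * v)) ^ 4 := by
    rw [div_pow, ← h5]; field_simp; ring
  have e2 : - -(r ^ 4 * v ^ 4)⁻¹ = (1 / (r * v)) ^ 4 := by field_simp
  have e3 : y ^ 4 - -(r ^ 4 * v ^ 4)⁻¹ = (q / (r * v)) ^ 4 := by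
    rw [div_pow, ← h4]; field_simp; ring
  have e4 : 1 - -(r ^ 4 * v ^ 4)⁻¹ = (w / (r * v)) ^ 4 := by
    rw [div_pow, ← h3]; field_simp; ring
  rw [kernelB1, e1, e2, e3, e4, h3, h4, h5]
  simp (disch := positivity) only [pow_four_rpow_half, pow_four_rpow_neg_quarter,
    pow_four_rpow_neg_three_quarters, pow_four_rpow_three_quarters]
  field_simp

theorem C1_eq {β b : ℝ} (hβ : 0 < β) (hb : 0 < b) (hb1 : b < 1) :
    C1 (-β⁻¹) b = b ^ (-(1:ℝ)/2) * β ^ (-(1:ℝ)/2) * (1 - b) ^ (-(1:ℝ)/2) *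
      ∫ u in Ioi 0, kernelC1 β b u := by
  have hb2 : 0 < 1 - b := by linarith
  rw [C1]
  refine setIntegral_eq_mul_of_substitution (f := fun u => b * (1 + u) / (1 + b * u))
    (k := fun z => (z - b) / (b * (1 - z)))
    (f' := fun u => b * (1 - b) / (1 + b * u) ^ 2) measurableSet_Ioi ?_ ?_ ?_ ?_ ?_ ?_
  · intro x hx
    have hx : 0 < x := hx
    refine ((((hasDerivAt_id' x).const_add 1).const_mul b).fun_div
      (((hasDerivAt_id' x).const_mul b).const_add 1)
      (show 1 + b * x ≠ 0 by positivity)).congr_deriv ?_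
    ring
  · intro u hu
    have hu : 0 < u := hu
    constructor
    · rw [lt_div_iff₀ (by positivity)]
      nlinarith [mul_pos (mul_pos hb hu) hb2]
    · rw [div_lt_one (by positivity)]
      linarith
  · rintro z ⟨h0, h1⟩
    exact div_pos (by linarith) (mul_pos hb (by linarith))
  · intro u hu
    have hu : 0 < u := hu
    have h1 : 1 - b * (1 + u) / (1 + b * u) = (1 - b) / (1 + b * u) := by field_simp; ring
    have h2 : b * (1 + u) / (1 + b * u) - b = b * u * (1 - b) / (1 + b * u) := by field_simp; ring
    simp only [h1, h2]
    field_simp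
  · rintro z ⟨h0, h1⟩
    have h2 : 0 < 1 - z := by linarith
    have h3 : 1 + (z - b) / (b * (1 - z)) = z * (1 - b) / (b * (1 - z)) := by field_simp; ring
    have h4 : 1 + b * ((z - b) / (b * (1 - z))) = (1 - b) / (1 - z) := by field_simp; ring
    simp only [h3, h4]
    field_simp
  · intro u hu
    have hu : 0 < u := hu
    obtain ⟨x, hx, h6⟩ := exists_pos_pow_four_eq hb2
    obtain ⟨y, hy, rfl⟩ := exists_pos_pow_four_eq hb
    obtain ⟨r, hr, rfl⟩ := exists_pos_pow_four_eq hβ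
    obtain ⟨v, hv, rfl⟩ := exists_pos_pow_four_eq hu
    obtain ⟨w, hw, h3⟩ := exists_pos_pow_four_eq (show 0 < 1 + v ^ 4 by positivity)
    obtain ⟨q, hq, h4⟩ := exists_pos_pow_four_eq (show 0 < 1 + y ^ 4 * v ^ 4 by positivity)
    obtain ⟨p, hp, h5⟩ := exists_pos_pow_four_eq
      (show 0 < 1 + r ^ 4 * (y ^ 4 * (1 + v ^ 4) / (1 + y ^ 4 * v ^ 4)) by positivity)
    have e1 : y ^ 4 * (1 + v ^ 4) / (1 + y ^ 4 * v ^ 4) - -(r ^ 4)⁻¹ = (p / r) ^ 4 := by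
      rw [div_pow, ← h5]; field_simp; ring
    have e2 : y ^ 4 * (1 + v ^ 4) / (1 + y ^ 4 * v ^ 4) = (y * w / q) ^ 4 := by
      rw [div_pow, mul_pow, ← h3, ← h4]
    have e3 : y ^ 4 * (1 + v ^ 4) / (1 + y ^ 4 * v ^ 4) - y ^ 4 = (y * v * x / q) ^ 4 := by
      rw [div_pow, mul_pow, mul_pow, ← h6, ← h4]; field_simp; ring
    have e4 : 1 - y ^ 4 * (1 + v ^ 4) / (1 + y ^ 4 * v ^ 4) = (x / q) ^ 4 := by
      rw [div_pow, ← h6, ← h4]; field_simp; ring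
    rw [kernelC1, e1, e3, e4, h5, e2, h3, h4, h6, abs_of_pos (by positivity)]
    simp (disch := positivity) only [pow_four_rpow_half, pow_four_rpow_neg_half,
      pow_four_rpow_quarter, pow_four_rpow_neg_three_quarters]
    field_simp

theorem A2_eq {β b : ℝ} (hβ : 0 < β) (hb : 0 < b) :
    A2 (-β⁻¹) b = β ^ ((1:ℝ)/4) * ∫ u in Ioo 0 1, kernelA2 β b u := by
  rw [A2]
  refine setIntegral_eq_mul_of_substitution (f := fun u => -(u / β)) (k := fun z => -(β * z))
    (f' := fun _ => -β⁻¹) measurableSet_Ioo ?_ ?_ ?_ ?_ ?_ ?_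
  · intro x _
    simpa using ((hasDerivAt_id' x).div_const β).fun_neg
  · rintro u ⟨h0, h1⟩
    refine ⟨?_, by simp only [Left.neg_neg_iff]; positivity⟩
    rw [neg_lt_neg_iff, ← one_div]
    gcongr
  · rintro z ⟨h0, h1⟩
    rw [neg_lt, ← one_div, lt_div_iff₀ hβ] at h0
    exact ⟨by nlinarith, by linarith⟩
  · intro u _
    field_simp
  · intro z _
    field_simp
  · rintro u ⟨h0, h1⟩
    have h2 : 0 < 1 - u := by linarith
    obtain ⟨y, hy, rfl⟩ := exists_pos_pow_four_eq hb
    obtain ⟨r, hr, rfl⟩ := exists_pos_pow_four_eq hβ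
    obtain ⟨v, hv, rfl⟩ := exists_pos_pow_four_eq h0
    obtain ⟨w, hw, h3⟩ := exists_pos_pow_four_eq (show 0 < v ^ 4 + r ^ 4 * y ^ 4 by positivity)
    obtain ⟨q, hq, h4⟩ := exists_pos_pow_four_eq (show 0 < v ^ 4 + r ^ 4 by positivity)
    obtain ⟨p, hp, h5⟩ := exists_pos_pow_four_eq h2
    have e1 : -(v ^ 4 / r ^ 4) - -(r ^ 4)⁻¹ = (p / r) ^ 4 := by
      rw [div_pow, ← h5]; field_simp; ring
    have e2 : - -(v ^ 4 / r ^ 4) = (v / r) ^ 4 := by rw [div_pow]; ring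
    have e3 : y ^ 4 - -(v ^ 4 / r ^ 4) = (w / r) ^ 4 := by
      rw [div_pow, ← h3]; field_simp; ring
    have e4 : 1 - -(v ^ 4 / r ^ 4) = (q / r) ^ 4 := by
      rw [div_pow, ← h4]; field_simp; ring
    rw [kernelA2, e1, e2, e3, e4, h3, h4, h5, abs_neg, abs_of_pos (by positivity)]
    simp (disch := positivity) only [pow_four_rpow_neg_half, pow_four_rpow_neg_quarter,
      pow_four_rpow_quarter]
    field_simp

theorem B2_eq {β b : ℝ} (hβ : 0 < β) (hb : 0 < b) :
    B2 (-β⁻¹) b = β ^ ((1:ℝ)/4) * ∫ u in Ioo 0 1, kernelB2 β b u := by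
  rw [B2]
  refine setIntegral_Iio_eq_mul_of_inversion hβ ?_
  rintro u ⟨h0, h1⟩
  have h2 : 0 < 1 - u := by linarith
  obtain ⟨y, hy, rfl⟩ := exists_pos_pow_four_eq hb
  obtain ⟨r, hr, rfl⟩ := exists_pos_pow_four_eq hβ
  obtain ⟨v, hv, rfl⟩ := exists_pos_pow_four_eq h0
  obtain ⟨w, hw, h3⟩ := exists_pos_pow_four_eq (show 0 < 1 + r ^ 4 * v ^ 4 by positivity)
  obtain ⟨q, hq, h4⟩ := exists_pos_pow_four_eq (show 0 < 1 + r ^ 4 * y ^ 4 * v ^ 4 by positivity)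
  obtain ⟨p, hp, h5⟩ := exists_pos_pow_four_eq h2
  have e1 : -(r ^ 4)⁻¹ - -(r ^ 4 * v ^ 4)⁻¹ = (p / (r * v)) ^ 4 := by
    rw [div_pow, ← h5]; field_simp; ring
  have e2 : - -(r ^ 4 * v ^ 4)⁻¹ = (1 / (r * v)) ^ 4 := by field_simp
  have e3 : y ^ 4 - -(r ^ 4 * v ^ 4)⁻¹ = (q / (r * v)) ^ 4 := by
    rw [div_pow, ← h4]; field_simp; ring
  have e4 : 1 - -(r ^ 4 * v ^ 4)⁻¹ = (w / (r * v)) ^ 4 := by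
    rw [div_pow, ← h3]; field_simp; ring
  rw [kernelB2, e1, e2, e3, e4, h3, h4, h5]
  simp (disch := positivity) only [pow_four_rpow_neg_half, pow_four_rpow_neg_quarter,
    pow_four_rpow_neg_three_quarters, pow_four_rpow_quarter]
  field_simp

theorem C2_eq {β b : ℝ} (hβ : 0 < β) (hb : 0 < b) (hb1 : b < 1) :
    C2 (-β⁻¹) b = β ^ ((1:ℝ)/2) * (1 - b) ^ ((1:ℝ)/2) * ∫ u in Ioi 0, kernelC2 β b u := by
  have hb2 : 0 < 1 - b := by linarith
  rw [C2]
  refine setIntegral_eq_mul_of_substitution (f := fun u => (b + u) / (1 + u))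
    (k := fun z => (z - b) / (1 - z))
    (f' := fun u => (1 - b) / (1 + u) ^ 2) measurableSet_Ioi ?_ ?_ ?_ ?_ ?_ ?_
  · intro x hx
    have hx : 0 < x := hx
    refine (((hasDerivAt_id' x).const_add b).fun_div ((hasDerivAt_id' x).const_add 1)
      (show 1 + x ≠ 0 by positivity)).congr_deriv ?_
    ring
  · intro u hu
    have hu : 0 < u := hu
    constructor
    · rw [lt_div_iff₀ (by positivity)]
      nlinarith [mul_pos hu hb2]
    · rw [div_lt_one (by positivity)]
      linarith
  · rintro z ⟨h0, h1⟩
    exact div_pos (sub_pos.2 h0) (sub_pos.2 h1)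
  · intro u hu
    have hu : 0 < u := hu
    have h1 : 1 - (b + u) / (1 + u) = (1 - b) / (1 + u) := by field_simp; ring
    have h2 : (b + u) / (1 + u) - b = u * (1 - b) / (1 + u) := by field_simp; ring
    simp only [h1, h2]
    field_simp
  · rintro z ⟨h0, h1⟩
    have h2 : 0 < 1 - z := by linarith
    have h3 : b + (z - b) / (1 - z) = z * (1 - b) / (1 - z) := by field_simp; ring
    have h4 : 1 + (z - b) / (1 - z) = (1 - b) / (1 - z) := by field_simp; ring
    simp only [h3, h4]
    field_simp
  · intro u hu
    have hu : 0 < u := hu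
    obtain ⟨x, hx, h6⟩ := exists_pos_pow_four_eq hb2
    obtain ⟨y, hy, rfl⟩ := exists_pos_pow_four_eq hb
    obtain ⟨r, hr, rfl⟩ := exists_pos_pow_four_eq hβ
    obtain ⟨v, hv, rfl⟩ := exists_pos_pow_four_eq hu
    obtain ⟨w, hw, h3⟩ := exists_pos_pow_four_eq (show 0 < 1 + v ^ 4 by positivity)
    obtain ⟨q, hq, h4⟩ := exists_pos_pow_four_eq (show 0 < y ^ 4 + v ^ 4 by positivity)
    obtain ⟨p, hp, h5⟩ := exists_pos_pow_four_eq
      (show 0 < 1 + r ^ 4 * ((y ^ 4 + v ^ 4) / (1 + v ^ 4)) by positivity)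
    have e1 : (y ^ 4 + v ^ 4) / (1 + v ^ 4) - -(r ^ 4)⁻¹ = (p / r) ^ 4 := by
      rw [div_pow, ← h5]; field_simp; ring
    have e2 : (y ^ 4 + v ^ 4) / (1 + v ^ 4) = (q / w) ^ 4 := by
      rw [div_pow, ← h3, ← h4]
    have e3 : (y ^ 4 + v ^ 4) / (1 + v ^ 4) - y ^ 4 = (v * x / w) ^ 4 := by
      rw [div_pow, mul_pow, ← h6, ← h3]; field_simp; ring
    have e4 : 1 - (y ^ 4 + v ^ 4) / (1 + v ^ 4) = (x / w) ^ 4 := by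
      rw [div_pow, ← h6, ← h3]; field_simp; ring
    rw [kernelC2, e1, e3, e4, h5, e2, h3, h4, h6, abs_of_pos (by positivity)]
    simp (disch := positivity) only [pow_four_rpow_half, pow_four_rpow_neg_half,
      pow_four_rpow_neg_quarter, pow_four_rpow_neg_five_quarters]
    field_simp

theorem integrableOn_Ioi_rpow_mul_one_add_rpow {p q : ℝ} (hp : -1 < p) (hq : q ≤ 0)
    (hpq : p + q < -1) : IntegrableOn (fun u : ℝ => u ^ p * (1 + u) ^ q) (Ioi 0) := by
  have hmeas : Measurable fun u : ℝ => u ^ p * (1 + u) ^ q := by fun_prop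
  rw [← Ioc_union_Ioi_eq_Ioi (zero_le_one' ℝ)]
  refine IntegrableOn.union ?_ ?_
  · have h : IntegrableOn (fun u : ℝ => u ^ p) (Ioc 0 1) :=
      (intervalIntegrable_iff_integrableOn_Ioc_of_le zero_le_one).1
        (intervalIntegral.intervalIntegrable_rpow' hp)
    refine Integrable.mono' h hmeas.aestronglyMeasurable
      ((ae_restrict_iff' measurableSet_Ioc).2 (.of_forall fun u hu => ?_))
    have hu0 : 0 < u := hu.1
    rw [Real.norm_of_nonneg (by positivity)]
    exact mul_le_of_le_one_right (by positivity)
      (Real.rpow_le_one_of_one_le_of_nonpos (by linarith) hq)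
  · refine Integrable.mono' (integrableOn_Ioi_rpow_of_lt hpq one_pos) hmeas.aestronglyMeasurable
      ((ae_restrict_iff' measurableSet_Ioi).2 (.of_forall fun u hu => ?_))
    have hu0 : 0 < u := one_pos.trans hu
    rw [Real.norm_of_nonneg (by positivity), Real.rpow_add hu0]
    gcongr ?_ * ?_
    exact Real.rpow_le_rpow_of_nonpos hu0 (by linarith) hq

theorem integrableOn_Ioo_one_sub_rpow_mul_rpow :
    IntegrableOn (fun u : ℝ => (1 - u) ^ (-(1:ℝ)/2) * u ^ (-(3:ℝ)/4)) (Ioo 0 1) := by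
  have h := Complex.betaIntegral_convergent (u := ((1/4 : ℝ) : ℂ)) (v := ((1/2 : ℝ) : ℂ))
    (by rw [Complex.ofReal_re]; norm_num) (by rw [Complex.ofReal_re]; norm_num)
  rw [intervalIntegrable_iff_integrableOn_Ioo_of_le zero_le_one] at h
  refine IntegrableOn.congr_fun h.norm (fun u hu => ?_) measurableSet_Ioo
  have h1 : 0 < 1 - u := sub_pos.2 hu.2
  have h2 : (1 : ℂ) - u = ((1 - u : ℝ) : ℂ) := by push_cast; rfl
  simp only [norm_mul]
  rw [h2, Complex.norm_cpow_eq_rpow_re_of_pos hu.1, Complex.norm_cpow_eq_rpow_re_of_pos h1, mul_comm]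
  congr 2 <;> simp <;> norm_num

/-- Parameters `(β, b)` for which the rescaled integrands are uniformly dominated. -/
def parameterBox : Set (ℝ × ℝ) := Icc 0 1 ×ˢ Icc 0 (1/2)

theorem integrableOn_and_continuousOn_of_dominated {k : ℝ → ℝ → ℝ → ℝ} {bound : ℝ → ℝ}
    {s : Set ℝ} {t : Set (ℝ × ℝ)} (hs : MeasurableSet s)
    (hmeas : ∀ β b, Measurable (k β b))
    (hbound : ∀ p ∈ t, ∀ u ∈ s, k p.1 p.2 u ∈ Icc 0 (bound u))
    (hint : IntegrableOn bound s)
    (hcont : ∀ u ∈ s, ContinuousOn (fun p : ℝ × ℝ => k p.1 p.2 u) t) :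
    (∀ p ∈ t, IntegrableOn (k p.1 p.2) s) ∧
      ContinuousOn (fun p : ℝ × ℝ => ∫ u in s, k p.1 p.2 u) t := by
  have hb : ∀ p ∈ t, ∀ᵐ u ∂volume.restrict s, ‖k p.1 p.2 u‖ ≤ bound u := fun p hp =>
    (ae_restrict_iff' hs).2 (.of_forall fun u hu => by
      rw [Real.norm_of_nonneg (hbound p hp u hu).1]
      exact (hbound p hp u hu).2)
  exact ⟨fun p hp => hint.mono' (hmeas _ _).aestronglyMeasurable (hb p hp),
    continuousOn_of_dominated (fun p _ => (hmeas _ _).aestronglyMeasurable) hb hint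
      ((ae_restrict_iff' hs).2 (.of_forall hcont))⟩

theorem kernelA1_integrableOn_and_continuousOn :
    (∀ p ∈ parameterBox, IntegrableOn (kernelA1 p.1 p.2) (Ioi 0)) ∧
      ContinuousOn (fun p : ℝ × ℝ => ∫ u in Ioi 0, kernelA1 p.1 p.2 u) parameterBox := by
  refine integrableOn_and_continuousOn_of_dominated measurableSet_Ioi
    (bound := fun u => u ^ (-(3:ℝ)/4) * (1 + u) ^ (-(3:ℝ)/4))
    (fun β b => by unfold kernelA1; fun_prop) ?_
    (integrableOn_Ioi_rpow_mul_one_add_rpow (by norm_num) (by norm_num) (by norm_num)) ?_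
  · rintro ⟨β, b⟩ ⟨⟨hβ, -⟩, hb, -⟩ u hu
    have hu : 0 < u := hu
    dsimp only at *
    have h1 : (1 + b * u) ^ (-(3:ℝ)/4) ≤ 1 :=
      Real.rpow_le_one_of_one_le_of_nonpos (by linarith [mul_nonneg hb hu.le]) (by norm_num)
    have h2 : (1 - β * b * u) ^ ((1:ℝ)/2) ≤ 1 := by
      rw [← Real.sqrt_eq_rpow]
      exact Real.sqrt_le_one.2 (by linarith [mul_nonneg (mul_nonneg hβ hb) hu.le])
    have h3 : 0 ≤ (1 - β * b * u) ^ ((1:ℝ)/2) := by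
      rw [← Real.sqrt_eq_rpow]; positivity
    refine ⟨by unfold kernelA1; positivity, ?_⟩
    exact (mul_le_of_le_one_right (by positivity) h2).trans
      (mul_le_of_le_one_right (by positivity) h1)
  · rintro u hu p ⟨⟨hβ, -⟩, hb, -⟩
    have hu : 0 < u := hu
    have h1 : 1 + p.2 * u ≠ 0 := by positivity
    unfold kernelA1
    refine ContinuousAt.continuousWithinAt ?_
    fun_prop (disch := first | assumption | exact Or.inl (by assumption) | (norm_num; done))

theorem kernelB1_continuousOn :
    ContinuousOn (fun p : ℝ × ℝ => ∫ u in Ioo 0 1, kernelB1 p.1 p.2 u) parameterBox := by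
  refine (integrableOn_and_continuousOn_of_dominated measurableSet_Ioo
    (bound := fun u => (1 - u) ^ (-(1:ℝ)/2) * u ^ (-(3:ℝ)/4))
    (fun β b => by unfold kernelB1; fun_prop) ?_ integrableOn_Ioo_one_sub_rpow_mul_rpow ?_).2
  · rintro ⟨β, b⟩ ⟨⟨hβ, -⟩, hb, -⟩ u ⟨hu, hu1⟩
    have h0 : 0 < 1 - u := by linarith
    dsimp only at *
    have h1 : (1 + β * b * u) ^ (-(3:ℝ)/4) ≤ 1 :=
      Real.rpow_le_one_of_one_le_of_nonpos (by linarith [mul_nonneg (mul_nonneg hβ hb) hu.le])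
        (by norm_num)
    have h2 : (1 + β * u) ^ (-(3:ℝ)/4) ≤ 1 :=
      Real.rpow_le_one_of_one_le_of_nonpos (by linarith [mul_nonneg hβ hu.le]) (by norm_num)
    refine ⟨by unfold kernelB1; positivity, ?_⟩
    have h3 : (1 - u) ^ ((1:ℝ)/2) * u ^ (-(1:ℝ)/4) ≤ (1 - u) ^ (-(1:ℝ)/2) * u ^ (-(3:ℝ)/4) := by
      gcongr ?_ * ?_
      · exact Real.rpow_le_rpow_of_exponent_ge h0 (by linarith) (by norm_num)
      · exact Real.rpow_le_rpow_of_exponent_ge hu hu1.le (by norm_num)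
    refine le_trans ?_ h3
    exact (mul_le_of_le_one_right (by positivity) h2).trans
      (mul_le_of_le_one_right (by positivity) h1)
  · rintro u ⟨hu, -⟩ p ⟨⟨hβ, -⟩, hb, -⟩
    have h1 : 1 + p.1 * p.2 * u ≠ 0 := by positivity
    have h2 : 1 + p.1 * u ≠ 0 := by positivity
    unfold kernelB1
    refine ContinuousAt.continuousWithinAt ?_
    fun_prop (disch := first | assumption | exact Or.inl (by assumption) | (norm_num; done))

theorem kernelC1_integrableOn_and_continuousOn :
    (∀ p ∈ parameterBox, IntegrableOn (kernelC1 p.1 p.2) (Ioi 0)) ∧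
      ContinuousOn (fun p : ℝ × ℝ => ∫ u in Ioi 0, kernelC1 p.1 p.2 u) parameterBox := by
  refine integrableOn_and_continuousOn_of_dominated measurableSet_Ioi
    (bound := fun u => u ^ (-(3:ℝ)/4) * (1 + u) ^ (-(1:ℝ)/2) * (2:ℝ) ^ ((1:ℝ)/2))
    (fun β b => by unfold kernelC1; fun_prop) ?_
    ((integrableOn_Ioi_rpow_mul_one_add_rpow (by norm_num) (by norm_num) (by norm_num)).mul_const _)
    ?_
  · rintro ⟨β, b⟩ ⟨⟨hβ, hβ1⟩, hb, hb1⟩ u hu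
    have hu : 0 < u := hu
    dsimp only at *
    refine ⟨by unfold kernelC1; positivity, ?_⟩
    have h1 : (1 + b * u) ^ ((1:ℝ)/4) ≤ (1 + u) ^ ((1:ℝ)/4) := by
      gcongr
      nlinarith
    have h2 : β * (b * (1 + u) / (1 + b * u)) ≤ 1 := by
      refine mul_le_one₀ hβ1 (by positivity) ((div_le_one (by positivity)).2 (by linarith))
    have h3 : (1 + u) ^ (-(1:ℝ)/2) = (1 + u) ^ (-(3:ℝ)/4) * (1 + u) ^ ((1:ℝ)/4) := by
      rw [← Real.rpow_add (by positivity)]; norm_num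
    rw [kernelC1, h3, ← mul_assoc]
    gcongr
    linarith
  · rintro u hu p ⟨⟨hβ, -⟩, hb, -⟩
    have hu : 0 < u := hu
    have h1 : 1 + p.2 * u ≠ 0 := by positivity
    unfold kernelC1
    refine ContinuousAt.continuousWithinAt ?_
    fun_prop (disch := first | assumption | exact Or.inl (by assumption) | (norm_num; done))

theorem kernelA2_integrableOn_and_continuousOn :
    (∀ p ∈ parameterBox, IntegrableOn (kernelA2 p.1 p.2) (Ioo 0 1)) ∧
      ContinuousOn (fun p : ℝ × ℝ => ∫ u in Ioo 0 1, kernelA2 p.1 p.2 u) parameterBox := by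
  refine integrableOn_and_continuousOn_of_dominated measurableSet_Ioo
    (bound := fun u => (1 - u) ^ (-(1:ℝ)/2) * u ^ (-(3:ℝ)/4))
    (fun β b => by unfold kernelA2; fun_prop) ?_ integrableOn_Ioo_one_sub_rpow_mul_rpow ?_
  · rintro ⟨β, b⟩ ⟨⟨hβ, -⟩, hb, -⟩ u ⟨hu, hu1⟩
    have h0 : 0 < 1 - u := by linarith
    dsimp only at *
    refine ⟨by unfold kernelA2; positivity, ?_⟩
    have h1 : (u + β * b) ^ (-(1:ℝ)/4) ≤ u ^ (-(1:ℝ)/4) :=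
      Real.rpow_le_rpow_of_nonpos hu (by linarith [mul_nonneg hβ hb]) (by norm_num)
    have h2 : (u + β) ^ (-(1:ℝ)/4) ≤ u ^ (-(1:ℝ)/4) :=
      Real.rpow_le_rpow_of_nonpos hu (by linarith) (by norm_num)
    have h3 : u ^ (-(3:ℝ)/4) = u ^ (-(1:ℝ)/4) * u ^ (-(1:ℝ)/4) * u ^ (-(1:ℝ)/4) := by
      rw [← Real.rpow_add hu, ← Real.rpow_add hu]; norm_num
    rw [kernelA2, h3, ← mul_assoc, ← mul_assoc]
    gcongr
  · rintro u ⟨hu, -⟩ p ⟨⟨hβ, -⟩, hb, -⟩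
    have h1 : u + p.1 * p.2 ≠ 0 := by positivity
    have h2 : u + p.1 ≠ 0 := by positivity
    unfold kernelA2
    refine ContinuousAt.continuousWithinAt ?_
    fun_prop (disch := first | assumption | exact Or.inl (by assumption) | (norm_num; done))

theorem kernelB2_integrableOn_and_continuousOn :
    (∀ p ∈ parameterBox, IntegrableOn (kernelB2 p.1 p.2) (Ioo 0 1)) ∧
      ContinuousOn (fun p : ℝ × ℝ => ∫ u in Ioo 0 1, kernelB2 p.1 p.2 u) parameterBox := by
  refine integrableOn_and_continuousOn_of_dominated measurableSet_Ioo
    (bound := fun u => (1 - u) ^ (-(1:ℝ)/2) * u ^ (-(3:ℝ)/4))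
    (fun β b => by unfold kernelB2; fun_prop) ?_ integrableOn_Ioo_one_sub_rpow_mul_rpow ?_
  · rintro ⟨β, b⟩ ⟨⟨hβ, -⟩, hb, -⟩ u ⟨hu, hu1⟩
    have h0 : 0 < 1 - u := by linarith
    dsimp only at *
    have h1 : (1 + β * b * u) ^ (-(1:ℝ)/4) ≤ 1 :=
      Real.rpow_le_one_of_one_le_of_nonpos (by linarith [mul_nonneg (mul_nonneg hβ hb) hu.le])
        (by norm_num)
    have h2 : (1 + β * u) ^ (-(1:ℝ)/4) ≤ 1 :=
      Real.rpow_le_one_of_one_le_of_nonpos (by linarith [mul_nonneg hβ hu.le]) (by norm_num)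
    refine ⟨by unfold kernelB2; positivity, ?_⟩
    exact (mul_le_of_le_one_right (by positivity) h2).trans
      (mul_le_of_le_one_right (by positivity) h1)
  · rintro u ⟨hu, -⟩ p ⟨⟨hβ, -⟩, hb, -⟩
    have h1 : 1 + p.1 * p.2 * u ≠ 0 := by positivity
    have h2 : 1 + p.1 * u ≠ 0 := by positivity
    unfold kernelB2
    refine ContinuousAt.continuousWithinAt ?_
    fun_prop (disch := first | assumption | exact Or.inl (by assumption) | (norm_num; done))

theorem kernelC2_integrableOn_and_continuousOn :
    (∀ p ∈ parameterBox, IntegrableOn (kernelC2 p.1 p.2) (Ioi 0)) ∧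
      ContinuousOn (fun p : ℝ × ℝ => ∫ u in Ioi 0, kernelC2 p.1 p.2 u) parameterBox := by
  refine integrableOn_and_continuousOn_of_dominated measurableSet_Ioi
    (bound := fun u => u ^ (-(1:ℝ)/2) * (1 + u) ^ (-(5:ℝ)/4))
    (fun β b => by unfold kernelC2; fun_prop) ?_
    (integrableOn_Ioi_rpow_mul_one_add_rpow (by norm_num) (by norm_num) (by norm_num)) ?_
  · rintro ⟨β, b⟩ ⟨⟨hβ, -⟩, hb, -⟩ u hu
    have hu : 0 < u := hu
    dsimp only at *
    refine ⟨by unfold kernelC2; positivity, ?_⟩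
    have h1 : (b + u) ^ (-(1:ℝ)/4) ≤ u ^ (-(1:ℝ)/4) :=
      Real.rpow_le_rpow_of_nonpos hu (by linarith) (by norm_num)
    have h2 : (1 + β * ((b + u) / (1 + u))) ^ (-(1:ℝ)/2) ≤ 1 :=
      Real.rpow_le_one_of_one_le_of_nonpos (le_add_of_nonneg_right (by positivity)) (by norm_num)
    have h3 : u ^ (-(1:ℝ)/2) = u ^ (-(1:ℝ)/4) * u ^ (-(1:ℝ)/4) := by
      rw [← Real.rpow_add hu]; norm_num
    rw [kernelC2, h3]
    refine (mul_le_of_le_one_right (by positivity) h2).trans ?_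
    gcongr
  · rintro u hu p ⟨⟨hβ, -⟩, hb, -⟩
    have hu : 0 < u := hu
    have h1 : p.2 + u ≠ 0 := by positivity
    have h2 : 1 + u ≠ 0 := by positivity
    have h3 : 1 + p.1 * ((p.2 + u) / (1 + u)) ≠ 0 := by positivity
    unfold kernelC2
    refine ContinuousAt.continuousWithinAt ?_
    fun_prop (disch := first | assumption | exact Or.inl (by assumption) | (norm_num; done))

theorem setIntegral_pos_of_pos_on_Ioo {s : Set ℝ} {f : ℝ → ℝ} {c d : ℝ} (hs : MeasurableSet s)
    (hf : IntegrableOn f s) (h0 : ∀ x ∈ s, 0 ≤ f x) (hcd : c < d) (hsub : Ioo c d ⊆ s)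
    (hpos : ∀ x ∈ Ioo c d, 0 < f x) : 0 < ∫ x in s, f x := by
  rw [setIntegral_pos_iff_support_of_nonneg_ae
    ((ae_restrict_iff' hs).2 (.of_forall h0)) hf]
  refine lt_of_lt_of_le ?_ (measure_mono (subset_inter (fun x hx => (hpos x hx).ne') hsub))
  simpa using hcd

theorem kernelA1_integral_pos {p : ℝ × ℝ} (hp : p ∈ parameterBox) :
    0 < ∫ u in Ioi 0, kernelA1 p.1 p.2 u := by
  refine setIntegral_pos_of_pos_on_Ioo measurableSet_Ioi
    (kernelA1_integrableOn_and_continuousOn.1 p hp) ?_ one_pos Ioo_subset_Ioi_self ?_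
  · obtain ⟨⟨hβ, -⟩, hb, -⟩ := hp
    intro u hu
    have hu : 0 < u := hu
    have h3 : 0 ≤ (1 - p.1 * p.2 * u) ^ ((1:ℝ)/2) := by
      rw [← Real.sqrt_eq_rpow]; positivity
    unfold kernelA1
    positivity
  · obtain ⟨⟨hβ, hβ1⟩, hb, hb1⟩ := hp
    rintro u ⟨hu, hu1⟩
    have h1 : p.1 * p.2 ≤ 1 := mul_le_one₀ hβ1 hb (by linarith)
    have h2 : 0 < 1 - p.1 * p.2 * u := by nlinarith
    unfold kernelA1
    positivity

theorem kernelA2_integral_pos {p : ℝ × ℝ} (hp : p ∈ parameterBox) :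
    0 < ∫ u in Ioo 0 1, kernelA2 p.1 p.2 u := by
  have hpos : ∀ u ∈ Ioo (0:ℝ) 1, 0 < kernelA2 p.1 p.2 u := by
    obtain ⟨⟨hβ, -⟩, hb, -⟩ := hp
    rintro u ⟨hu, hu1⟩
    have h0 : 0 < 1 - u := by linarith
    unfold kernelA2
    positivity
  exact setIntegral_pos_of_pos_on_Ioo measurableSet_Ioo
    (kernelA2_integrableOn_and_continuousOn.1 p hp) (fun u hu => (hpos u hu).le) one_pos
    subset_rfl hpos

theorem kernelC2_integral_pos {p : ℝ × ℝ} (hp : p ∈ parameterBox) :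
    0 < ∫ u in Ioi 0, kernelC2 p.1 p.2 u := by
  have hpos : ∀ u ∈ Ioi (0:ℝ), 0 < kernelC2 p.1 p.2 u := by
    obtain ⟨⟨hβ, -⟩, hb, -⟩ := hp
    intro u hu
    have hu : 0 < u := hu
    unfold kernelC2
    positivity
  exact setIntegral_pos_of_pos_on_Ioo measurableSet_Ioi
    (kernelC2_integrableOn_and_continuousOn.1 p hp) (fun u hu => (hpos u hu).le) one_pos
    Ioo_subset_Ioi_self fun u hu => hpos u hu.1

theorem kernelA2_integral_le_kernelB2_integral {p : ℝ × ℝ} (hp : p ∈ parameterBox) :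
    ∫ u in Ioo 0 1, kernelA2 p.1 p.2 u ≤ ∫ u in Ioo 0 1, kernelB2 p.1 p.2 u := by
  refine setIntegral_mono_on (kernelA2_integrableOn_and_continuousOn.1 p hp)
    (kernelB2_integrableOn_and_continuousOn.1 p hp) measurableSet_Ioo ?_
  obtain ⟨⟨hβ, -⟩, hb, -⟩ := hp
  rintro u ⟨hu, hu1⟩
  have h0 : 0 < 1 - u := by linarith
  have aux : ∀ c, 0 ≤ c → (u + c) ^ (-(1:ℝ)/4) ≤ u ^ (-(1:ℝ)/4) * (1 + c * u) ^ (-(1:ℝ)/4) := by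
    intro c hc
    rw [← Real.mul_rpow hu.le (by positivity)]
    refine Real.rpow_le_rpow_of_nonpos (by positivity) ?_ (by norm_num)
    nlinarith [mul_nonneg hc (show 0 ≤ 1 - u ^ 2 by nlinarith)]
  have h3 : u ^ (-(3:ℝ)/4) = u ^ (-(1:ℝ)/4) * u ^ (-(1:ℝ)/4) * u ^ (-(1:ℝ)/4) := by
    rw [← Real.rpow_add hu, ← Real.rpow_add hu]; norm_num
  calc kernelA2 p.1 p.2 u
      ≤ (1 - u) ^ (-(1:ℝ)/2) * u ^ (-(1:ℝ)/4) *
          (u ^ (-(1:ℝ)/4) * (1 + p.1 * p.2 * u) ^ (-(1:ℝ)/4)) *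
          (u ^ (-(1:ℝ)/4) * (1 + p.1 * u) ^ (-(1:ℝ)/4)) := by
        unfold kernelA2
        gcongr
        · exact aux _ (by positivity)
        · exact aux _ hβ
    _ = kernelB2 p.1 p.2 u := by
        rw [kernelB2, h3]; ring

theorem kernelA1_integral_lt_kernelC1_integral {b : ℝ} (hb : 0 < b) (hb1 : b ≤ 1/2) :
    ∫ u in Ioi 0, kernelA1 0 b u < ∫ u in Ioi 0, kernelC1 0 b u := by
  have hp : ((0:ℝ), b) ∈ parameterBox := ⟨⟨le_rfl, zero_le_one⟩, hb.le, hb1⟩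
  have hA := kernelA1_integrableOn_and_continuousOn.1 _ hp
  have hC := kernelC1_integrableOn_and_continuousOn.1 _ hp
  have hpos : ∀ u ∈ Ioi (0:ℝ), 0 < kernelC1 0 b u - kernelA1 0 b u := by
    intro u hu
    have hu : 0 < u := hu
    have h1 : (1 + b * u) ^ (-(3:ℝ)/4) < (1 + b * u) ^ ((1:ℝ)/4) :=
      Real.rpow_lt_rpow_of_exponent_lt (lt_add_of_pos_right _ (by positivity)) (by norm_num)
    simp only [kernelC1, kernelA1, zero_mul, add_zero, sub_zero, Real.one_rpow, mul_one]
    rw [sub_pos]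
    gcongr
  rw [← sub_pos, ← integral_sub hC hA]
  exact setIntegral_pos_of_pos_on_Ioo measurableSet_Ioi (hC.sub hA)
    (fun u hu => (hpos u hu).le) one_pos Ioo_subset_Ioi_self fun u hu => hpos u hu.1

/-- Cross-multiplied difference of the two period quotients at `a = -β⁻¹`, in terms of the rescaled
integrals; it extends continuously to `β = 0` and to `b = 0`. -/
noncomputable def periodGap (p : ℝ × ℝ) : ℝ :=
  (p.2 ^ ((1:ℝ)/2) * p.1 ^ ((5:ℝ)/4) * (∫ u in Ioo 0 1, kernelB1 p.1 p.2 u) +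
      (1 - p.2) ^ (-(1:ℝ)/2) * ∫ u in Ioi 0, kernelC1 p.1 p.2 u) *
    (∫ u in Ioo 0 1, kernelA2 p.1 p.2 u) -
  ((∫ u in Ioo 0 1, kernelB2 p.1 p.2 u) +
      p.1 ^ ((1:ℝ)/4) * (1 - p.2) ^ ((1:ℝ)/2) * ∫ u in Ioi 0, kernelC2 p.1 p.2 u) *
    ∫ u in Ioi 0, kernelA1 p.1 p.2 u

theorem periodGap_continuousOn : ContinuousOn periodGap parameterBox := by
  have h2 : ContinuousOn (fun p : ℝ × ℝ => p.2 ^ ((1:ℝ)/2)) parameterBox := by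
    fun_prop (disch := norm_num)
  have h3 : ContinuousOn (fun p : ℝ × ℝ => p.1 ^ ((5:ℝ)/4)) parameterBox := by
    fun_prop (disch := norm_num)
  have h4 : ContinuousOn (fun p : ℝ × ℝ => p.1 ^ ((1:ℝ)/4)) parameterBox := by
    fun_prop (disch := norm_num)
  have h5 : ContinuousOn (fun p : ℝ × ℝ => (1 - p.2) ^ ((1:ℝ)/2)) parameterBox := by
    fun_prop (disch := norm_num)
  have h6 : ContinuousOn (fun p : ℝ × ℝ => (1 - p.2) ^ (-(1:ℝ)/2)) parameterBox :=
    ContinuousOn.rpow_const (by fun_prop) fun p hp => Or.inl (by linarith [hp.2.2])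
  exact (((h2.mul h3).mul kernelB1_continuousOn).add
    (h6.mul kernelC1_integrableOn_and_continuousOn.2)).mul
      kernelA2_integrableOn_and_continuousOn.2 |>.sub
    ((kernelB2_integrableOn_and_continuousOn.2.add
      ((h4.mul h5).mul kernelC2_integrableOn_and_continuousOn.2)).mul
      kernelA1_integrableOn_and_continuousOn.2)

theorem periodGap_pos_of_fst_eq_zero {b : ℝ} (hb : 0 < b) (hb1 : b ≤ 1/2) :
    0 < periodGap (0, b) := by
  have hp : ((0:ℝ), b) ∈ parameterBox := ⟨⟨le_rfl, zero_le_one⟩, hb.le, hb1⟩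
  have hA2 := kernelA2_integral_pos hp
  have hA1 := kernelA1_integral_pos hp
  have hlt := kernelA1_integral_lt_kernelC1_integral hb hb1
  have heq : ∫ u in Ioo 0 1, kernelB2 0 b u = ∫ u in Ioo 0 1, kernelA2 0 b u := by
    refine setIntegral_congr_fun measurableSet_Ioo ?_
    rintro u ⟨hu, -⟩
    have h3 : u ^ (-(3:ℝ)/4) = u ^ (-(1:ℝ)/4) * u ^ (-(1:ℝ)/4) * u ^ (-(1:ℝ)/4) := by
      rw [← Real.rpow_add hu, ← Real.rpow_add hu]; norm_num
    simp only [kernelB2, kernelA2, zero_mul, add_zero, Real.one_rpow, mul_one, h3]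
    ring
  have h1 : 1 ≤ (1 - b) ^ (-(1:ℝ)/2) :=
    Real.one_le_rpow_of_pos_of_le_one_of_nonpos (by linarith) (by linarith) (by norm_num)
  have e1 : (0:ℝ) ^ ((5:ℝ)/4) = 0 := Real.zero_rpow (by norm_num)
  have e2 : (0:ℝ) ^ ((1:ℝ)/4) = 0 := Real.zero_rpow (by norm_num)
  simp only [periodGap, heq, e1, e2, mul_zero, zero_mul, zero_add, add_zero]
  dsimp only at hA1 hA2
  have h2 := le_mul_of_one_le_left (hA1.trans hlt).le h1
  rw [mul_comm (∫ u in Ioo 0 1, kernelA2 0 b u), ← sub_mul]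
  exact mul_pos (by linarith) hA2

theorem periodGap_neg_of_snd_eq_zero {β : ℝ} (hβ : 0 < β) (hβ1 : β ≤ 1) :
    periodGap (β, 0) < 0 := by
  have hp : (β, (0:ℝ)) ∈ parameterBox := ⟨⟨hβ.le, hβ1⟩, le_rfl, by norm_num⟩
  have hA1 := kernelA1_integral_pos hp
  have hC2 := kernelC2_integral_pos hp
  have hle := kernelA2_integral_le_kernelB2_integral hp
  have heq : ∫ u in Ioi 0, kernelC1 β 0 u = ∫ u in Ioi 0, kernelA1 β 0 u := by
    simp [kernelC1, kernelA1]
  have e1 : (0:ℝ) ^ ((1:ℝ)/2) = 0 := Real.zero_rpow (by norm_num)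
  simp only [periodGap, heq, e1, sub_zero, Real.one_rpow, mul_one, one_mul, zero_mul, zero_add]
  dsimp only at hA1 hC2 hle
  rw [mul_comm, ← sub_mul]
  refine mul_neg_of_neg_of_pos ?_ hA1
  have := mul_pos (Real.rpow_pos_of_pos hβ ((1:ℝ)/4)) hC2
  linarith

theorem period_quotients_eq_of_periodGap_eq_zero {β b : ℝ} (hβ : 0 < β) (hβ1 : β ≤ 1)
    (hb : 0 < b) (hb1 : b ≤ 1/2) (h : periodGap (β, b) = 0) :
    (B1 (-β⁻¹) b + C1 (-β⁻¹) b) / A1 (-β⁻¹) b =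
      (B2 (-β⁻¹) b + C2 (-β⁻¹) b) / A2 (-β⁻¹) b := by
  have hp : (β, b) ∈ parameterBox := ⟨⟨hβ.le, hβ1⟩, hb.le, hb1⟩
  have hA1 := kernelA1_integral_pos hp
  have hA2 := kernelA2_integral_pos hp
  rw [A1_eq hβ hb, B1_eq hβ hb, C1_eq hβ hb (by linarith), A2_eq hβ hb, B2_eq hβ hb,
    C2_eq hβ hb (by linarith), div_eq_div_iff (by positivity) (by positivity)]
  rw [periodGap] at h
  dsimp only at h hA1 hA2
  have e1 : β ^ ((3:ℝ)/4) = b ^ (-(1:ℝ)/2) * β ^ (-(1:ℝ)/2) * (b ^ ((1:ℝ)/2) * β ^ ((5:ℝ)/4)) := by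
    rw [mul_mul_mul_comm, ← Real.rpow_add hb, ← Real.rpow_add hβ]; norm_num
  have e2 : β ^ ((1:ℝ)/2) = β ^ ((1:ℝ)/4) * β ^ ((1:ℝ)/4) := by
    rw [← Real.rpow_add hβ]; norm_num
  rw [e1, e2]
  linear_combination b ^ (-(1:ℝ)/2) * β ^ (-(1:ℝ)/2) * β ^ ((1:ℝ)/4) * h

theorem cs4_period_solutions_near_costa_limit :
    ∀ N : ℝ, 0 < N → ∀ ε : ℝ, 0 < ε →
      ∃ a b : ℝ, a < -N ∧ 0 < b ∧ b < ε ∧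
        (B1 a b + C1 a b) / A1 a b = (B2 a b + C2 a b) / A2 a b := by
  intro N hN ε hε
  obtain ⟨b₀, hb₀, hb₀ε, hb₀1⟩ : ∃ b₀ : ℝ, 0 < b₀ ∧ b₀ ≤ ε ∧ b₀ ≤ 1/2 :=
    ⟨min ε (1/2), by positivity, min_le_left _ _, min_le_right _ _⟩
  obtain ⟨β, hβ, hβ1, hβN, hgap⟩ :
      ∃ β : ℝ, 0 < β ∧ β ≤ 1 ∧ β < N⁻¹ ∧ 0 < periodGap (β, b₀) := by
    have hcont : ContinuousOn (fun β => periodGap (β, b₀)) (Icc 0 1) :=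
      periodGap_continuousOn.comp (by fun_prop) fun β hβ => ⟨hβ, hb₀.le, hb₀1⟩
    have hev : ∀ᶠ β in nhdsWithin (0:ℝ) (Ioi 0), 0 < periodGap (β, b₀) := by
      have h := (hcont 0 ⟨le_rfl, zero_le_one⟩).mono_left
        (nhdsWithin_le_of_mem (Icc_mem_nhdsGT one_pos))
      exact h.eventually_const_lt (periodGap_pos_of_fst_eq_zero hb₀ hb₀1)
    obtain ⟨β, h1, h2, h3⟩ := (hev.and (Filter.inter_mem (Ioc_mem_nhdsGT one_pos)
      (Ioo_mem_nhdsGT (inv_pos.2 hN)))).exists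
    exact ⟨β, h2.1, h2.2, h3.2, h1⟩
  have hcont : ContinuousOn (fun b => periodGap (β, b)) (Icc 0 b₀) :=
    periodGap_continuousOn.comp (by fun_prop) fun b hb => ⟨⟨hβ.le, hβ1⟩, hb.1, hb.2.trans hb₀1⟩
  obtain ⟨b, ⟨hb, hbb₀⟩, h0⟩ := intermediate_value_Ioo hb₀.le hcont
    ⟨periodGap_neg_of_snd_eq_zero hβ hβ1, hgap⟩
  refine ⟨-β⁻¹, b, ?_, hb, hbb₀.trans_le hb₀ε,
    period_quotients_eq_of_periodGap_eq_zero hβ hβ1 hb (hbb₀.le.trans hb₀1) h0⟩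
  rwa [neg_lt_neg_iff, lt_inv_comm₀ hN hβ]
end

section
/- Let a, b be real numbers with a < 0 < b < 1. For every complex number z with Im z > 0, the complex number (z - a) / (√(1-z) · √z · √(z-b)) (principal branch square roots) is not a negative real number. (This is the squared Gauss map G(z)² of the CS-4 surface; the statement implies the Gauss map is never horizontal on the interior of the fundamental pentagon, which is the key analytic step in the embeddedness proof.) -/
namespace Complex

lemma cpow_one_half_mul_self (w : ℂ) : w ^ ((1:ℂ)/2) * w ^ ((1:ℂ)/2) = w := by
  rw [← sq, one_div]
  exact cpow_ofNat_inv_pow w 2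

lemma cpow_one_half_re_pos {w : ℂ} (hw : w ∈ slitPlane) : 0 < (w ^ ((1:ℂ)/2)).re := by
  obtain ⟨harg, hw0⟩ := mem_slitPlane_iff_arg.mp hw
  have him : (log w * ((1:ℂ)/2)).im = w.arg / 2 := by
    rw [show (1:ℂ)/2 = ((1/2 : ℝ) : ℂ) by norm_num, im_mul_ofReal, log_im]
    ring
  rw [cpow_def_of_ne_zero hw0, exp_re, him]
  have h_lower := neg_pi_lt_arg w
  have h_upper := lt_of_le_of_ne (arg_le_pi w) harg
  exact mul_pos (Real.exp_pos _) (Real.cos_pos_of_mem_Ioo ⟨by linarith, by linarith⟩)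

lemma im_eq_two_mul_cpow_one_half_re_mul_im (w : ℂ) :
    w.im = 2 * (w ^ ((1:ℂ)/2)).re * (w ^ ((1:ℂ)/2)).im := by
  conv_lhs => rw [← cpow_one_half_mul_self w, mul_im]
  ring

lemma cpow_one_half_im_pos {w : ℂ} (hw : 0 < w.im) : 0 < (w ^ ((1:ℂ)/2)).im := by
  have hre := cpow_one_half_re_pos (Or.inr hw.ne')
  rw [im_eq_two_mul_cpow_one_half_re_mul_im w] at hw
  exact pos_of_mul_pos_right hw (by positivity)

lemma cpow_one_half_im_neg {w : ℂ} (hw : w.im < 0) : (w ^ ((1:ℂ)/2)).im < 0 := by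
  have hre := cpow_one_half_re_pos (Or.inr hw.ne)
  rw [im_eq_two_mul_cpow_one_half_re_mul_im w] at hw
  exact neg_of_mul_neg_right hw (by positivity)

/-- The map `z ↦ √(1 - z) * √z` sends the upper half plane to the right half plane. -/
lemma cpow_one_half_one_sub_mul_re_pos {z : ℂ} (hz : 0 < z.im) :
    0 < ((1 - z) ^ ((1:ℂ)/2) * z ^ ((1:ℂ)/2)).re := by
  have him : (1 - z).im < 0 := by simpa using hz
  rw [mul_re, sub_pos]
  exact (mul_neg_of_neg_of_pos (cpow_one_half_im_neg him) (cpow_one_half_im_pos hz)).trans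
    (mul_pos (cpow_one_half_re_pos (Or.inr him.ne))
      (cpow_one_half_re_pos (Or.inr hz.ne')))

/-- The map `w ↦ (w + c) / √w = √w + c / √w` with `0 ≤ c` sends the slit plane to the right
half plane. -/
lemma add_ofReal_div_cpow_one_half_re_pos {w : ℂ} (hw : w ∈ slitPlane) {c : ℝ} (hc : 0 ≤ c) :
    0 < ((w + c) / w ^ ((1:ℂ)/2)).re := by
  have hre := cpow_one_half_re_pos hw
  have hne : w ^ ((1:ℂ)/2) ≠ 0 := ne_of_apply_ne re hre.ne'
  have heq : (w + c) / w ^ ((1:ℂ)/2) = w ^ ((1:ℂ)/2) + c * (w ^ ((1:ℂ)/2))⁻¹ := by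
    rw [add_div, div_eq_mul_inv (c : ℂ)]
    congr 1
    rw [div_eq_iff hne, cpow_one_half_mul_self]
  rw [heq, add_re, re_ofReal_mul, inv_re]
  have := normSq_nonneg (w ^ ((1:ℂ)/2))
  positivity

end Complex

theorem cs4_squared_gauss_map_not_negative_real :
    ∀ a b : ℝ, a < 0 → 0 < b → b < 1 →
      ∀ z : ℂ, 0 < z.im →
        ¬ ∃ r : ℝ, r < 0 ∧
          (z - (a:ℂ)) /
            ((1 - z) ^ ((1:ℂ)/2) * z ^ ((1:ℂ)/2) * (z - (b:ℂ)) ^ ((1:ℂ)/2)) = (r:ℂ) := by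
  rintro a b ha hb - z hz ⟨r, hr, h⟩
  have hP := Complex.cpow_one_half_one_sub_mul_re_pos hz
  have hzb : z - (b:ℂ) ∈ Complex.slitPlane :=
    Or.inr (by simpa using hz.ne')
  have hQ := Complex.add_ofReal_div_cpow_one_half_re_pos hzb (c := b - a) (by linarith)
  have hP0 : (1 - z) ^ ((1:ℂ)/2) * z ^ ((1:ℂ)/2) ≠ 0 := ne_of_apply_ne Complex.re hP.ne'
  rw [mul_comm, ← div_div, div_eq_iff hP0] at h
  rw [show z - (b:ℂ) + ((b - a : ℝ) : ℂ) = z - a by push_cast; ring, h,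
    Complex.re_ofReal_mul] at hQ
  exact (mul_neg_of_neg_of_pos hr hP).not_gt hQ
end
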